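/- Fix λ > 0, γ > 0, ε ≥ 0 with γ² + ε² = 1, σ_z > 0, and fix τ > 0, β > 0. Under the working assumptions (g ∈ ℝᵐ, h ∈ ℝⁿ with iid N(0,1) entries, x₀ with k entries iid p_{X₀} of zero mean and unit variance and the rest zero, m/n → δ, k/n → κ, all mutually independent), the normalized objective (1/n)·D̃(τ,β,g,h) converges in probability, as n → ∞, to D(τ,β) = (βτ/2)(δ−1) + βσ_z²/(2τ) − β²/4 + βε²κ/(2τ) + (β/τ)·E[e(γX₀ + τH ; 2λτ/β)]. -/

import Mathlib

open MeasureTheory ProbabilityTheory Filter Set Topology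

/-!
STATEMENT 14: Fix `λ > 0`, `γ > 0`, `ε ≥ 0` with `γ² + ε² = 1`, `σ_z > 0`, and
fix `τ > 0`, `β > 0`. Under the working assumptions (`g ∈ ℝᵐ`, `h ∈ ℝⁿ` with iid
`N(0,1)` entries, `x₀` with `k` entries iid `p_{X₀}` of zero mean and unit
variance and the rest zero, `m/n → δ`, `k/n → κ`, all mutually independent),
the normalized objective `(1/n)·D̃(τ,β,g,h)` converges in probability, as
`n → ∞`, to
`D(τ,β) = (βτ/2)(δ−1) + βσ_z²/(2τ) − β²/4 + βε²κ/(2τ) + (β/τ)·E[e(γX₀ + τH ; 2λτ/β)]`,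
where `X₀` has the sparse distribution placing mass `κ` on `p_{X₀}` and mass
`1 − κ` at `0`, and `H ∼ N(0,1)` is independent of `X₀`.
-/

/-- Squared Euclidean norm. -/
def sqnorm {n : ℕ} (v : Fin n → ℝ) : ℝ := ∑ i, (v i) ^ 2

/-- Euclidean inner product. -/
def dotp {n : ℕ} (u v : Fin n → ℝ) : ℝ := ∑ i, u i * v i

/-- The optimal value `e(a;λ)` of the soft-thresholding problem. -/
noncomputable def softVal (a lam : ℝ) : ℝ :=
  if lam < a then lam * a - lam ^ 2 / 2
  else if a < -lam then -(lam * a) - lam ^ 2 / 2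
  else a ^ 2 / 2

/-- The sparse distribution: mass `κ` on `p` and mass `1 − κ` at `0`. -/
noncomputable def sparseMix (κ : ℝ) (p : Measure ℝ) : Measure ℝ :=
  ENNReal.ofReal κ • p + ENNReal.ofReal (1 - κ) • Measure.dirac 0

/-- The deterministic scalar objective `D(τ,β)`, with `X₀ ∼ μ` and `H ∼ N(0,1)`
independent. -/
noncomputable def Dfun (δ κ σz γ ε lam : ℝ) (μ : Measure ℝ) (τ β : ℝ) : ℝ :=
  β * τ / 2 * (δ - 1) + β * σz ^ 2 / (2 * τ) - β ^ 2 / 4 + β * ε ^ 2 * κ / (2 * τ)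
    + β / τ * ∫ q : ℝ × ℝ, softVal (γ * q.1 + τ * q.2) (2 * lam * τ / β)
        ∂(μ.prod (gaussianReal 0 1))

/-- The random scalar objective `D̃(τ,β,g,h)` of the paper. -/
noncomputable def Dtilde {m n : ℕ} (σz γ ε lam : ℝ) (g : Fin m → ℝ) (h x0 : Fin n → ℝ)
    (τ β : ℝ) : ℝ :=
  β * τ * sqnorm g / 2 + (n : ℝ) * β * σz ^ 2 / (2 * τ) - (n : ℝ) * β ^ 2 / 4
    + β / τ * (∑ i, (ε ^ 2 / 2 * (x0 i) ^ 2 - γ * h i * x0 i - τ ^ 2 / 2 * (h i) ^ 2))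
    + β / γ * dotp h x0
    + β / τ * ∑ i, softVal (γ * x0 i + τ * h i) (2 * lam * τ / β)

/-- The weak law of large numbers for sums of `N n` i.i.d. terms, normalized by `n`. -/
theorem tendstoInMeasure_infinitePi_sum {E : Type*} [MeasurableSpace E] (ν : Measure E)
    [IsProbabilityMeasure ν] {f : E → ℝ} (hf : Measurable f) (hfi : Integrable f ν)
    {N : ℕ → ℕ} {c : ℝ} (hc : 0 < c) (hN : Tendsto (fun n => (N n : ℝ) / n) atTop (𝓝 c)) :
    TendstoInMeasure (Measure.infinitePi fun _ : ℕ => ν)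
      (fun (n : ℕ) x => (1 / (n : ℝ)) * ∑ i ∈ Finset.range (N n), f (x i)) atTop
      (fun _ => c * ∫ e, f e ∂ν) := by
  set μ := Measure.infinitePi fun _ : ℕ => ν
  have hNtop : Tendsto N atTop atTop := by
    rw [← tendsto_natCast_atTop_iff (R := ℝ)]
    refine (hN.pos_mul_atTop hc (tendsto_natCast_atTop_atTop (R := ℝ))).congr' ?_
    filter_upwards [eventually_gt_atTop 0] with n hn
    field_simp
  have hmp : ∀ i, MeasurePreserving (Function.eval i) μ ν :=
    fun i => measurePreserving_eval_infinitePi (fun _ : ℕ => ν) i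
  have hindep : iIndepFun (fun (i : ℕ) (x : ℕ → E) => f (x i)) μ :=
    iIndepFun_infinitePi (P := fun _ : ℕ => ν) (X := fun _ => f) fun _ => hf
  have hident : ∀ i, IdentDistrib (fun x : ℕ → E => f (x i)) (fun x => f (x 0)) μ μ := by
    intro i
    have h0 : IdentDistrib (Function.eval i) (Function.eval 0) μ μ :=
      ⟨(hmp i).measurable.aemeasurable, (hmp 0).measurable.aemeasurable,
        (hmp i).map_eq.trans (hmp 0).map_eq.symm⟩
    exact h0.comp hf
  have hint : Integrable (fun x : ℕ → E => f (x 0)) μ := (hmp 0).integrable_comp_of_integrable hfi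
  have hval : ∫ x, f (x 0) ∂μ = ∫ e, f e ∂ν := by
    rw [← (hmp 0).map_eq, integral_map (hmp 0).measurable.aemeasurable hf.aestronglyMeasurable]
  have hslln := strong_law_ae_real (fun (i : ℕ) (x : ℕ → E) => f (x i)) hint
    (fun i j hij => hindep.indepFun hij) hident
  refine tendstoInMeasure_of_tendsto_ae (fun n => ?_) ?_
  · exact Measurable.aestronglyMeasurable (by fun_prop)
  · filter_upwards [hslln] with x hx
    rw [hval] at hx
    refine (hN.mul (hx.comp hNtop)).congr fun n => ?_
    rcases Nat.eq_zero_or_pos (N n) with h0 | h0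
    · simp [h0]
    · simp only [Function.comp_apply]
      have h1 : (N n : ℝ) ≠ 0 := by positivity
      field_simp

/-- The weak law of large numbers for triangular arrays of i.i.d. rows. -/
theorem tendsto_measure_array_sum {E : Type*} [MeasurableSpace E] (ν : Measure E)
    [IsProbabilityMeasure ν] {f : E → ℝ} (hf : Measurable f) (hfi : Integrable f ν)
    {Ω : ℕ → Type*} [∀ n, MeasurableSpace (Ω n)] (P : ∀ n, Measure (Ω n))
    (ι : ℕ → Type*) [∀ n, Fintype (ι n)] (X : ∀ n, Ω n → ι n → E)
    (hX : ∀ n, Measure.map (X n) (P n) = Measure.pi fun _ : ι n => ν)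
    {c : ℝ} (hc : 0 < c)
    (hcard : Tendsto (fun n => (Fintype.card (ι n) : ℝ) / n) atTop (𝓝 c))
    {ζ : ℝ} (hζ : 0 < ζ) :
    Tendsto (fun n => P n {ω | ζ ≤ |(1 / (n : ℝ)) * ∑ i, f (X n ω i) - c * ∫ e, f e ∂ν|})
      atTop (𝓝 0) := by
  refine (tendstoInMeasure_infinitePi_sum ν hf hfi hc hcard (ENNReal.ofReal ζ)
    (ENNReal.ofReal_pos.2 hζ)).congr fun n => ?_
  have hXm : AEMeasurable (X n) (P n) :=
    aemeasurable_of_map_neZero ⟨by rw [hX n]; exact IsProbabilityMeasure.ne_zero _⟩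
  let e := Fintype.equivFin (ι n)
  have hmap := Measure.map_infinitePi_infinitePi_of_inj (P := fun _ : ℕ => ν)
    (f := fun i : ι n => (e i : ℕ)) (Fin.val_injective.comp e.injective)
  rw [Measure.infinitePi_eq_pi (ι := ι n), ← hX n] at hmap
  have hS : MeasurableSet {y : ι n → E |
      ζ ≤ |(1 / (n : ℝ)) * ∑ i, f (y i) - c * ∫ e, f e ∂ν|} :=
    measurableSet_le measurable_const (by fun_prop)
  have h1 := Measure.map_apply_of_aemeasurable hXm hS
  rw [← hmap, Measure.map_apply (by fun_prop) hS] at h1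
  refine Eq.trans ?_ h1
  congr 1
  ext x
  simp only [mem_ofPred_eq, mem_preimage, edist_dist, Real.dist_eq]
  rw [ENNReal.ofReal_le_ofReal_iff (abs_nonneg _),
    Equiv.sum_comp e (fun j : Fin _ => f (x j)), Fin.sum_univ_eq_sum_range (fun j => f (x j))]

theorem measurable_softVal (lam : ℝ) : Measurable fun a => softVal a lam := by
  unfold softVal
  refine Measurable.ite (measurableSet_lt measurable_const measurable_id) (by fun_prop) ?_
  exact Measurable.ite (measurableSet_lt measurable_id measurable_const) (by fun_prop)
    (by fun_prop)

theorem abs_softVal_le {lam : ℝ} (hlam : 0 < lam) (a : ℝ) : |softVal a lam| ≤ lam * |a| := by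
  unfold softVal
  split_ifs with h1 h2
  · rw [abs_of_pos (by linarith : 0 < a), abs_le]
    constructor <;> nlinarith
  · rw [abs_of_neg (by linarith : a < 0), abs_le]
    constructor <;> nlinarith
  · have h3 : |a| ≤ lam := abs_le.2 ⟨by linarith, by linarith⟩
    rw [abs_of_nonneg (by positivity), ← sq_abs]
    nlinarith [abs_nonneg a]

theorem integrable_softVal {E : Type*} [MeasurableSpace E] {μ : Measure E} {f : E → ℝ} {lam : ℝ}
    (hlam : 0 < lam) (hf : Integrable f μ) : Integrable (fun e => softVal (f e) lam) μ := by
  refine (hf.abs.const_mul lam).mono' ?_ (ae_of_all _ fun e => ?_)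
  · exact ((measurable_softVal lam).comp_aemeasurable hf.aemeasurable).aestronglyMeasurable
  · exact abs_softVal_le hlam _

theorem integral_sparseMix_prod {κ : ℝ} (hκ0 : 0 ≤ κ) (hκ1 : κ ≤ 1) (p ν : Measure ℝ)
    [IsProbabilityMeasure p] [IsProbabilityMeasure ν] {f : ℝ × ℝ → ℝ} (hf : Measurable f)
    (h1 : Integrable f (p.prod ν)) (h0 : Integrable (fun y => f (0, y)) ν) :
    ∫ q, f q ∂((sparseMix κ p).prod ν)
      = κ * ∫ q, f q ∂(p.prod ν) + (1 - κ) * ∫ y, f (0, y) ∂ν := by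
  have hm : Measurable (Prod.mk (0 : ℝ) : ℝ → ℝ × ℝ) := measurable_prodMk_left
  have h0' : Integrable f ((Measure.dirac 0).prod ν) := by
    rw [Measure.dirac_prod, integrable_map_measure hf.aestronglyMeasurable hm.aemeasurable]
    exact h0
  unfold sparseMix
  rw [Measure.add_prod, Measure.prod_smul_left, Measure.prod_smul_left,
    integral_add_measure (h1.smul_measure ENNReal.ofReal_ne_top)
      (h0'.smul_measure ENNReal.ofReal_ne_top), integral_smul_measure, integral_smul_measure,
    Measure.dirac_prod, integral_map hm.aemeasurable hf.aestronglyMeasurable,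
    ENNReal.toReal_ofReal hκ0, ENNReal.toReal_ofReal (by linarith)]
  rfl

theorem integral_sq_gaussianReal_zero_one : ∫ x, x ^ 2 ∂(gaussianReal 0 1) = 1 := by
  have h := variance_id_gaussianReal (μ := 0) (v := 1)
  rw [variance_of_integral_eq_zero measurable_id.aemeasurable
    (by simp [integral_id_gaussianReal (μ := 0) (v := 1)])] at h
  simpa using h

theorem integrable_sq_gaussianReal : Integrable (fun x => x ^ 2) (gaussianReal 0 1) :=
  (memLp_id_gaussianReal 2).integrable_sq

theorem integrable_id_gaussianReal : Integrable (fun x => x) (gaussianReal 0 1) :=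
  (memLp_id_gaussianReal 1).integrable (by simp)

/-- Restricting an i.i.d. vector to the indices satisfying `s` gives an i.i.d. vector. -/
theorem measurePreserving_subtype_restrict_pi {ι : Type*} [Fintype ι] (s : ι → Prop) [DecidablePred s]
    {E : Type*} [MeasurableSpace E] (ν : Measure E) [IsProbabilityMeasure ν] :
    MeasurePreserving (fun (y : ι → E) (i : {j // s j}) => y i) (Measure.pi fun _ => ν)
      (Measure.pi fun _ : {j // s j} => ν) :=
  measurePreserving_fst.comp (measurePreserving_piEquivPiSubtypeProd (fun _ : ι => ν) s)

/-- If `(Y, X)` is independent, `Y` is i.i.d. with law `ν` and `X` restricted to `s` is i.i.d. with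
law `p`, then the pairs indexed by `s` are i.i.d. with law `p.prod ν`. -/
theorem map_pairs_eq_pi {ι Ω : Type*} [Fintype ι] [MeasurableSpace Ω] (P : Measure Ω)
    (s : ι → Prop) [DecidablePred s] (p ν : Measure ℝ) [IsProbabilityMeasure p]
    [IsProbabilityMeasure ν] {X Y : Ω → ι → ℝ} (hX : AEMeasurable X P) (hY : AEMeasurable Y P)
    (hYlaw : Measure.map Y P = Measure.pi fun _ => ν)
    (hXlaw : Measure.map (fun ω (i : {j // s j}) => X ω i) P = Measure.pi fun _ => p)
    (hXY : Measure.map (fun ω => (Y ω, X ω)) P = (Measure.map Y P).prod (Measure.map X P))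
    [IsProbabilityMeasure P] :
    Measure.map (fun ω (i : {j // s j}) => (X ω i, Y ω i)) P
      = Measure.pi fun _ => p.prod ν := by
  have : IsProbabilityMeasure (Measure.map X P) := Measure.isProbabilityMeasure_map hX
  have hr : Measurable fun (y : ι → ℝ) (i : {j // s j}) => y i := by fun_prop
  have hXr : MeasurePreserving (fun (y : ι → ℝ) (i : {j // s j}) => y i) (Measure.map X P)
      (Measure.pi fun _ => p) :=
    ⟨hr, by rw [AEMeasurable.map_map_of_aemeasurable hr.aemeasurable hX, ← hXlaw]; rfl⟩
  have hswap : MeasurePreserving Prod.swap ((Measure.map Y P).prod (Measure.map X P))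
      ((Measure.map X P).prod (Measure.map Y P)) := by
    rw [hYlaw]; exact Measure.measurePreserving_swap
  have hprod := hXr.prod (hYlaw ▸ measurePreserving_subtype_restrict_pi s ν)
  have hall := ((measurePreserving_arrowProdEquivProdArrow ℝ ℝ {j // s j} (fun _ => p)
    (fun _ => ν)).symm.comp hprod).comp hswap
  rw [← hall.map_eq, ← hXY, AEMeasurable.map_map_of_aemeasurable hall.measurable.aemeasurable
    (hY.prodMk hX)]
  rfl

/-- The contribution of a single coordinate `q = (x₀ᵢ, hᵢ)` to the random objective. -/
noncomputable def coordTerm (γ ε lam τ β : ℝ) (q : ℝ × ℝ) : ℝ :=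
  β / τ * (ε ^ 2 / 2 * q.1 ^ 2 - τ ^ 2 / 2 * q.2 ^ 2) + (β / γ - β / τ * γ) * (q.1 * q.2)
    + β / τ * softVal (γ * q.1 + τ * q.2) (2 * lam * τ / β)

theorem measurable_coordTerm (γ ε lam τ β : ℝ) : Measurable (coordTerm γ ε lam τ β) := by
  have h : Measurable fun q : ℝ × ℝ => softVal (γ * q.1 + τ * q.2) (2 * lam * τ / β) :=
    (measurable_softVal _).comp (by fun_prop)
  unfold coordTerm
  fun_prop

/-- Integrability and mean of the contribution of a coordinate whose components are independent,
with a centred second component of unit variance. -/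
theorem integral_coordTerm {γ ε lam τ β : ℝ} (hlam : 0 < lam) (hτ : 0 < τ) (hβ : 0 < β)
    (p ν : Measure ℝ) [IsProbabilityMeasure p] [IsProbabilityMeasure ν]
    (hp1 : Integrable (fun x => x) p) (hp2 : Integrable (fun x => x ^ 2) p)
    (hν1 : Integrable (fun x => x) ν) (hν2 : Integrable (fun x => x ^ 2) ν)
    (hνm : ∫ x, x ∂ν = 0) (hνv : ∫ x, x ^ 2 ∂ν = 1) :
    Integrable (coordTerm γ ε lam τ β) (p.prod ν) ∧
    ∫ q, coordTerm γ ε lam τ β q ∂(p.prod ν)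
      = β / τ * (ε ^ 2 / 2 * ∫ x, x ^ 2 ∂p - τ ^ 2 / 2)
        + β / τ * ∫ q : ℝ × ℝ, softVal (γ * q.1 + τ * q.2) (2 * lam * τ / β) ∂(p.prod ν) := by
  have i1 : Integrable (fun q : ℝ × ℝ => q.1 ^ 2) (p.prod ν) := hp2.comp_fst ν
  have i2 : Integrable (fun q : ℝ × ℝ => q.2 ^ 2) (p.prod ν) := hν2.comp_snd p
  have i3 : Integrable (fun q : ℝ × ℝ => q.1 * q.2) (p.prod ν) := hp1.mul_prod hν1
  have i4 : Integrable (fun q : ℝ × ℝ => softVal (γ * q.1 + τ * q.2) (2 * lam * τ / β))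
      (p.prod ν) :=
    integrable_softVal (by positivity)
      (((hp1.comp_fst ν).const_mul γ).add ((hν1.comp_snd p).const_mul τ))
  have j1 : Integrable (fun q : ℝ × ℝ => ε ^ 2 / 2 * q.1 ^ 2) (p.prod ν) := i1.const_mul _
  have j2 : Integrable (fun q : ℝ × ℝ => τ ^ 2 / 2 * q.2 ^ 2) (p.prod ν) := i2.const_mul _
  have j12 : Integrable
      (fun q : ℝ × ℝ => β / τ * (ε ^ 2 / 2 * q.1 ^ 2 - τ ^ 2 / 2 * q.2 ^ 2)) (p.prod ν) :=
    (j1.sub j2).const_mul _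
  have j3 : Integrable (fun q : ℝ × ℝ => (β / γ - β / τ * γ) * (q.1 * q.2)) (p.prod ν) :=
    i3.const_mul _
  have j123 : Integrable (fun q : ℝ × ℝ => β / τ * (ε ^ 2 / 2 * q.1 ^ 2 - τ ^ 2 / 2 * q.2 ^ 2)
      + (β / γ - β / τ * γ) * (q.1 * q.2)) (p.prod ν) := j12.add j3
  have j4 := i4.const_mul (β / τ)
  refine ⟨j123.add j4, ?_⟩
  unfold coordTerm
  rw [integral_add j123 j4, integral_add j12 j3, integral_const_mul, integral_sub j1 j2,
    integral_const_mul, integral_const_mul, integral_const_mul, integral_const_mul,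
    integral_prod_mul (fun x => x) (fun x => x), hνm, integral_fun_fst (fun x : ℝ => x ^ 2),
    integral_fun_snd (fun x : ℝ => x ^ 2), hνv]
  simp

theorem Dtilde_eq_sum {m n : ℕ} (σz γ ε lam : ℝ) (g : Fin m → ℝ) (h x0 : Fin n → ℝ) (τ β : ℝ) :
    Dtilde σz γ ε lam g h x0 τ β
      = ∑ i, β * τ / 2 * g i ^ 2 + n * (β * σz ^ 2 / (2 * τ) - β ^ 2 / 4)
        + ∑ i, coordTerm γ ε lam τ β (x0 i, h i) := by
  unfold Dtilde coordTerm sqnorm dotp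
  simp only [Finset.sum_add_distrib, ← Finset.mul_sum, Finset.sum_sub_distrib]
  have h1 : ∑ i, γ * h i * x0 i = γ * ∑ i, x0 i * h i := by
    rw [Finset.mul_sum]; exact Finset.sum_congr rfl fun i _ => by ring
  have h2 : ∑ i, h i * x0 i = ∑ i, x0 i * h i :=
    Finset.sum_congr rfl fun i _ => mul_comm _ _
  rw [h1, h2]
  ring

/-- A sum of three error terms that vanish in probability vanishes in probability. -/
theorem tendsto_measure_abs_add_three {Ω : ℕ → Type*} [∀ n, MeasurableSpace (Ω n)]
    (P : ∀ n, Measure (Ω n)) {A B C D : ∀ n, Ω n → ℝ} {ζ : ℝ}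
    (hA : Tendsto (fun n => P n {ω | ζ / 3 ≤ |A n ω|}) atTop (𝓝 0))
    (hB : Tendsto (fun n => P n {ω | ζ / 3 ≤ |B n ω|}) atTop (𝓝 0))
    (hC : Tendsto (fun n => P n {ω | ζ / 3 ≤ |C n ω|}) atTop (𝓝 0))
    (hD : ∀ᶠ n in atTop, ∀ ω, D n ω = A n ω + B n ω + C n ω) :
    Tendsto (fun n => P n {ω | ζ ≤ |D n ω|}) atTop (𝓝 0) := by
  have hsum := (hA.add hB).add hC
  simp only [add_zero] at hsum
  refine tendsto_of_tendsto_of_tendsto_of_le_of_le' tendsto_const_nhds hsum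
    (Eventually.of_forall fun _ => zero_le) ?_
  filter_upwards [hD] with n hn
  refine (measure_mono ?_).trans
    ((measure_union_le _ _).trans (add_le_add_left (measure_union_le _ _) _))
  intro ω hω
  simp only [mem_ofPred_eq, mem_union] at hω ⊢
  by_contra! hcon
  rw [hn ω] at hω
  linarith [abs_add_three (A n ω) (B n ω) (C n ω), hcon.1.1, hcon.1.2, hcon.2]

theorem pointwise_convergence_of_scalar_objective
    (lam γ ε σz δ κ τ β : ℝ)
    (hlam : 0 < lam) (hγ : 0 < γ) (hε : 0 ≤ ε) (hγε : γ ^ 2 + ε ^ 2 = 1)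
    (hσ : 0 < σz) (hδ : 0 < δ) (hκ0 : 0 < κ) (hκ1 : κ < 1) (hτ : 0 < τ) (hβ : 0 < β)
    (m k : ℕ → ℕ)
    (hmδ : Tendsto (fun n => (m n : ℝ) / n) atTop (𝓝 δ))
    (hkκ : Tendsto (fun n => (k n : ℝ) / n) atTop (𝓝 κ))
    (p : Measure ℝ) (hp : IsProbabilityMeasure p)
    (hpm : ∫ x, x ∂p = 0) (hpv : ∫ x, x ^ 2 ∂p = 1)
    (Ωs : ℕ → Type) [∀ n, MeasurableSpace (Ωs n)]
    (P : ∀ n, Measure (Ωs n)) (hP : ∀ n, IsProbabilityMeasure (P n))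
    (g : ∀ n : ℕ, Ωs n → Fin (m n) → ℝ)
    (h : ∀ n : ℕ, Ωs n → Fin n → ℝ) (x0 : ∀ n : ℕ, Ωs n → Fin n → ℝ)
    (supp : ∀ n : ℕ, Finset (Fin n)) (hsupp : ∀ n, (supp n).card = k n)
    (hglaw : ∀ n, Measure.map (g n) (P n) = Measure.pi fun _ : Fin (m n) => gaussianReal 0 1)
    (hhlaw : ∀ n, Measure.map (h n) (P n) = Measure.pi fun _ : Fin n => gaussianReal 0 1)
    (hx0law : ∀ n, Measure.map (fun ω (i : {j : Fin n // j ∈ supp n}) => x0 n ω i.1) (P n)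
        = Measure.pi fun _ : {j : Fin n // j ∈ supp n} => p)
    (hx0off : ∀ n, ∀ ω, ∀ i ∉ supp n, x0 n ω i = 0)
    (hindep : ∀ n, Measure.map (fun ω => (g n ω, h n ω, x0 n ω)) (P n)
        = (Measure.map (g n) (P n)).prod
            ((Measure.map (h n) (P n)).prod (Measure.map (x0 n) (P n)))) :
    ∀ ζ > 0, Tendsto (fun n => P n {ω |
        ζ ≤ |(1 / (n : ℝ)) * Dtilde σz γ ε lam (g n ω) (h n ω) (x0 n ω) τ β
          - Dfun δ κ σz γ ε lam (sparseMix κ p) τ β|}) atTop (𝓝 0) := by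
  intro ζ hζ
  have hζ3 : 0 < ζ / 3 := by positivity
  have hg1 := integrable_id_gaussianReal
  have hg2 := integrable_sq_gaussianReal
  have hgm : ∫ x, x ∂(gaussianReal 0 1) = 0 := integral_id_gaussianReal
  have hgv := integral_sq_gaussianReal_zero_one
  have hp2 : Integrable (fun x => x ^ 2) p := by
    by_contra hcon
    rw [integral_undef hcon] at hpv
    exact zero_ne_one hpv
  have hp1 : Integrable (fun x => x) p :=
    ((memLp_two_iff_integrable_sq measurable_id.aestronglyMeasurable).2 hp2).integrable (by simp)
  have hL : 0 < 2 * lam * τ / β := by positivity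
  obtain ⟨hFi, hFv⟩ := integral_coordTerm (γ := γ) (ε := ε) hlam hτ hβ p (gaussianReal 0 1)
    hp1 hp2 hg1 hg2 hgm hgv
  have hd1 : Integrable (fun x : ℝ => x) (Measure.dirac 0) := integrable_dirac (by simp)
  have hd2 : Integrable (fun x : ℝ => x ^ 2) (Measure.dirac 0) := integrable_dirac (by simp)
  obtain ⟨hF0i, hF0v⟩ := integral_coordTerm (γ := γ) (ε := ε) hlam hτ hβ (Measure.dirac 0)
    (gaussianReal 0 1) hd1 hd2 hg1 hg2 hgm hgv
  have hFm := measurable_coordTerm γ ε lam τ β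
  have hsm : Measurable fun q : ℝ × ℝ => softVal (γ * q.1 + τ * q.2) (2 * lam * τ / β) :=
    (measurable_softVal _).comp (by fun_prop)
  have hm0 : Measurable (Prod.mk (0 : ℝ) : ℝ → ℝ × ℝ) := measurable_prodMk_left
  rw [Measure.dirac_prod] at hF0i hF0v
  rw [integrable_map_measure hFm.aestronglyMeasurable hm0.aemeasurable] at hF0i
  rw [integral_map hm0.aemeasurable hFm.aestronglyMeasurable,
    integral_map hm0.aemeasurable hsm.aestronglyMeasurable] at hF0v
  have hmix := integral_sparseMix_prod hκ0.le hκ1.le p (gaussianReal 0 1) hsm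
    (integrable_softVal hL (((hp1.comp_fst _).const_mul γ).add ((hg1.comp_snd p).const_mul τ)))
    (integrable_softVal hL ((integrable_const (γ * 0)).add (hg1.const_mul τ)))
  have hgae : ∀ n, AEMeasurable (g n) (P n) := fun n =>
    aemeasurable_of_map_neZero ⟨by rw [hglaw n]; exact IsProbabilityMeasure.ne_zero _⟩
  have hhae : ∀ n, AEMeasurable (h n) (P n) := fun n =>
    aemeasurable_of_map_neZero ⟨by rw [hhlaw n]; exact IsProbabilityMeasure.ne_zero _⟩
  have hxae : ∀ n, AEMeasurable (x0 n) (P n) := by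
    intro n
    have hr : AEMeasurable (fun ω (i : {j : Fin n // j ∈ supp n}) => x0 n ω i.1) (P n) :=
      aemeasurable_of_map_neZero ⟨by rw [hx0law n]; exact IsProbabilityMeasure.ne_zero _⟩
    refine aemeasurable_pi_iff.2 fun i => ?_
    by_cases hi : i ∈ supp n
    · exact aemeasurable_pi_iff.1 hr ⟨i, hi⟩
    · simp only [hx0off n _ i hi]
      exact aemeasurable_const
  have hhx : ∀ n, Measure.map (fun ω => (h n ω, x0 n ω)) (P n)
      = (Measure.map (h n) (P n)).prod (Measure.map (x0 n) (P n)) := by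
    intro n
    have : IsProbabilityMeasure (Measure.map (g n) (P n)) :=
      Measure.isProbabilityMeasure_map (hgae n)
    have h1 := congrArg (Measure.map Prod.snd) (hindep n)
    rwa [AEMeasurable.map_map_of_aemeasurable measurable_snd.aemeasurable
      ((hgae n).prodMk ((hhae n).prodMk (hxae n))), measurePreserving_snd.map_eq] at h1
  have hA := tendsto_measure_array_sum (gaussianReal 0 1) (f := fun x => β * τ / 2 * x ^ 2)
    (by fun_prop) (hg2.const_mul _) P (fun n => Fin (m n)) g hglaw hδ (by simpa using hmδ) hζ3
  have hB := tendsto_measure_array_sum (p.prod (gaussianReal 0 1)) hFm hFi P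
    (fun n => {j : Fin n // j ∈ supp n}) (fun n ω i => (x0 n ω i, h n ω i))
    (fun n => by
      convert map_pairs_eq_pi (P n) (· ∈ supp n) p (gaussianReal 0 1) (hxae n) (hhae n)
        (hhlaw n) (by convert hx0law n) (hhx n)) hκ0 (by simpa [hsupp] using hkκ) hζ3
  have hcompl : Tendsto (fun n => (Fintype.card {j : Fin n // j ∉ supp n} : ℝ) / n) atTop
      (𝓝 (1 - κ)) := by
    refine (hkκ.const_sub 1).congr' ?_
    filter_upwards [eventually_gt_atTop 0] with n hn
    have hle : k n ≤ n := by simpa [hsupp] using Finset.card_le_univ (supp n)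
    rw [Fintype.card_subtype_compl, Fintype.card_coe, hsupp, Fintype.card_fin, Nat.cast_sub hle]
    field_simp
  have hC := tendsto_measure_array_sum (gaussianReal 0 1) (hFm.comp hm0) hF0i P
    (fun n => {j : Fin n // j ∉ supp n}) (fun n ω i => h n ω i)
    (fun n => by
      have hr := measurePreserving_subtype_restrict_pi (· ∉ supp n) (gaussianReal 0 1)
      rw [← hr.map_eq, ← hhlaw n,
        AEMeasurable.map_map_of_aemeasurable hr.measurable.aemeasurable (hhae n)]
      rfl) (by linarith) hcompl hζ3
  refine tendsto_measure_abs_add_three P hA hB hC ?_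
  filter_upwards [eventually_gt_atTop 0] with n hn ω
  have hsplit := Fintype.sum_subtype_add_sum_subtype (· ∈ supp n)
    fun i => coordTerm γ ε lam τ β (x0 n ω i, h n ω i)
  rw [Subsingleton.elim (Subtype.fintype (· ∈ supp n)) (Finset.Subtype.fintype (supp n))] at hsplit
  have hoff : ∑ i : {j : Fin n // j ∉ supp n}, coordTerm γ ε lam τ β (x0 n ω i, h n ω i)
      = ∑ i : {j : Fin n // j ∉ supp n}, (coordTerm γ ε lam τ β ∘ Prod.mk 0) (h n ω i) :=
    Finset.sum_congr rfl fun i _ => by rw [hx0off n ω i i.2]; rfl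
  rw [hoff] at hsplit
  have hF0v' : ∫ y, (coordTerm γ ε lam τ β ∘ Prod.mk 0) y ∂(gaussianReal 0 1)
      = β / τ * (ε ^ 2 / 2 * ∫ x, x ^ 2 ∂(Measure.dirac (0 : ℝ)) - τ ^ 2 / 2)
        + β / τ * ∫ y, softVal (γ * 0 + τ * y) (2 * lam * τ / β) ∂(gaussianReal 0 1) := hF0v
  rw [Dtilde_eq_sum, ← hsplit, Dfun, hmix, hFv, hF0v', hpv, integral_const_mul, hgv,
    integral_dirac]
  have hn' : (n : ℝ) ≠ 0 := by positivity
  field_simp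
  ring
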